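/- There exists an infinite family of pairs (T1,T2) of unrooted binary phylogenetic trees on common label sets such that d_tw(T1,T2) = 1 while d_MP(T1,T2) is unbounded over the family; that is, for every M ∈ ℕ there exist unrooted binary phylogenetic trees T1, T2 on a common label set X with d_tw(T1,T2) = 1 and d_MP(T1,T2) > M. (In the doubled quartet construction one has d_MP(T^i_1, T^i_2) ≥ 2·2^i − 2^i = 2^i.) -/

import Mathlib

open SimpleGraph

/-- `G` has a tree decomposition of width at most `k`: a tree `t` together with
bags satisfying (tw1), (tw2) and (tw3), all of whose bags have size at most `k+1`. -/
def HasTreeDecompWidthLE {V : Type*} (G : SimpleGraph V) (k : ℕ) : Prop :=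
  ∃ (n : ℕ) (t : SimpleGraph (Fin (n + 1))) (bag : Fin (n + 1) → Finset V),
    t.IsTree ∧
    (∀ v : V, ∃ i, v ∈ bag i) ∧
    (∀ u v : V, G.Adj u v → ∃ i, u ∈ bag i ∧ v ∈ bag i) ∧
    (∀ v : V, (t.induce {i | v ∈ bag i}).Connected) ∧
    (∀ i, (bag i).card ≤ k + 1)

/-- The treewidth of a graph: the least `k` such that `G` has a tree decomposition
of width `k`. -/
noncomputable def treewidth {V : Type*} (G : SimpleGraph V) : ℕ :=
  sInf {k | HasTreeDecompWidthLE G k}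

/-- An unrooted binary phylogenetic graph (tree or network) on label set `X`:
a finite connected graph whose degree-1 vertices are bijectively labelled by `X`
and all of whose other vertices have degree 3. -/
structure PhyloGraph (V : Type*) (X : Type*) where
  graph : SimpleGraph V
  finite : Finite V
  connected : graph.Connected
  leaf : X → V
  leaf_inj : Function.Injective leaf
  leaf_deg : ∀ x : X, (graph.neighborSet (leaf x)).ncard = 1
  internal_deg : ∀ v : V, (∀ x : X, leaf x ≠ v) → (graph.neighborSet v).ncard = 3

/-- An unrooted binary phylogenetic tree on label set `X`. -/
structure PhyloTree (V : Type*) (X : Type*) extends PhyloGraph V X where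
  acyclic : graph.IsAcyclic

open Classical in
/-- The map identifying a leaf of the second graph with the leaf of the first
graph carrying the same label. -/
noncomputable def mergeMap {V1 V2 X : Type*} (l1 : X → V1) (l2 : X → V2) :
    V1 ⊕ V2 → V1 ⊕ V2
  | Sum.inl v => Sum.inl v
  | Sum.inr w => if h : ∃ x, l2 x = w then Sum.inl (l1 h.choose) else Sum.inr w

lemma mergeMap_idem {V1 V2 X : Type*} (l1 : X → V1) (l2 : X → V2) (u : V1 ⊕ V2) :
    mergeMap l1 l2 (mergeMap l1 l2 u) = mergeMap l1 l2 u := by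
  classical
  cases u with
  | inl v => rfl
  | inr w =>
    by_cases h : ∃ x, l2 x = w
    · simp [mergeMap, h]
    · simp [mergeMap, h]

/-- The vertex set of the display graph: the disjoint union of the vertex sets
of the two graphs, with leaves carrying the same label identified. -/
def DisplayVertex {V1 V2 X : Type*} (l1 : X → V1) (l2 : X → V2) : Type _ :=
  {u : V1 ⊕ V2 // mergeMap l1 l2 u = u}

/-- The canonical map from `V1 ⊕ V2` to the vertex set of the display graph. -/
noncomputable def toDisplay {V1 V2 X : Type*} (l1 : X → V1) (l2 : X → V2) (u : V1 ⊕ V2) :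
    DisplayVertex l1 l2 :=
  ⟨mergeMap l1 l2 u, mergeMap_idem l1 l2 u⟩

/-- The display graph of two leaf-labelled graphs: their disjoint union with the
leaves carrying the same label identified. -/
noncomputable def displayGraph {V1 V2 X : Type*} (G1 : SimpleGraph V1) (l1 : X → V1)
    (G2 : SimpleGraph V2) (l2 : X → V2) : SimpleGraph (DisplayVertex l1 l2) :=
  SimpleGraph.fromRel (fun a b =>
    (∃ u v : V1, G1.Adj u v ∧ a = toDisplay l1 l2 (Sum.inl u) ∧ b = toDisplay l1 l2 (Sum.inl v)) ∨
    (∃ u v : V2, G2.Adj u v ∧ a = toDisplay l1 l2 (Sum.inr u) ∧ b = toDisplay l1 l2 (Sum.inr v)))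

/-- The treewidth distance between two phylogenetic trees:
`d_tw(T1,T2) = tw(D(T1,T2)) - 2`. -/
noncomputable def dtw {V1 V2 X : Type*} (T1 : PhyloTree V1 X) (T2 : PhyloTree V2 X) : ℕ :=
  treewidth (displayGraph T1.graph T1.leaf T2.graph T2.leaf) - 2

/-- Two phylogenetic trees are compatible if there is a label-preserving
isomorphism between them. -/
def Compatible {V1 V2 X : Type*} (T1 : PhyloTree V1 X) (T2 : PhyloTree V2 X) : Prop :=
  ∃ φ : T1.graph ≃g T2.graph, ∀ x : X, φ (T1.leaf x) = T2.leaf x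

/-- The parsimony score of the character `f` on the leaf-labelled graph `(G, l)`:
the minimum, over all extensions `g` of `f` to the vertices, of the number of
edges whose endpoints receive different states. -/
noncomputable def parsimonyScore {V X C : Type*} (G : SimpleGraph V) (l : X → V)
    (f : X → C) : ℕ :=
  sInf {m | ∃ g : V → C, (∀ x, g (l x) = f x) ∧
    {e | e ∈ G.edgeSet ∧ ∃ u v : V, e = s(u, v) ∧ g u ≠ g v}.ncard = m}

/-- The maximum parsimony distance between two phylogenetic trees:
`d_MP(T1,T2) = max_f |l_f(T1) - l_f(T2)|`, the maximum over all characters `f`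
(surjections from `X` to a finite set of states) of the absolute difference of
the parsimony scores. -/
noncomputable def dMP {V1 V2 X : Type*} (T1 : PhyloTree V1 X) (T2 : PhyloTree V2 X) : ℕ :=
  sSup {m | ∃ (k : ℕ) (f : X → Fin k), Function.Surjective f ∧
    m = max (parsimonyScore T1.graph T1.leaf f - parsimonyScore T2.graph T2.leaf f)
            (parsimonyScore T2.graph T2.leaf f - parsimonyScore T1.graph T1.leaf f)}


/-- The graph joining every vertex to its parent. -/
def parGraph {V : Type*} (par : V → V) : SimpleGraph V :=
  SimpleGraph.fromRel (fun v w => par v = w)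

lemma parGraph_adj {V : Type*} (par : V → V) (v w : V) :
    (parGraph par).Adj v w ↔ v ≠ w ∧ (par v = w ∨ par w = v) := by
  simp [parGraph, SimpleGraph.fromRel_adj]

lemma parGraph_connected {V : Type*} (par : V → V) (d : V → ℕ) (root : V)
    (h : ∀ v, v ≠ root → d (par v) < d v) : (parGraph par).Connected := by
  have key : ∀ n, ∀ v, d v = n → (parGraph par).Reachable v root := by
    intro n
    induction n using Nat.strong_induction_on with
    | _ n ih =>
      intro v hv
      by_cases hr : v = root
      · subst hr; exact SimpleGraph.Reachable.refl _
      · have hlt := h v hr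
        have hadj : (parGraph par).Adj v (par v) := by
          rw [parGraph_adj]
          refine ⟨fun e => ?_, Or.inl rfl⟩
          rw [← e] at hlt
          exact lt_irrefl _ hlt
        exact hadj.reachable.trans (ih _ (hv ▸ hlt) _ rfl)
  have : Nonempty V := ⟨root⟩
  exact SimpleGraph.Connected.mk
    (fun v w => (key _ v rfl).trans (key _ w rfl).symm)

lemma parGraph_acyclic {V : Type*} (par : V → V) (d : V → ℕ) (root : V)
    (hroot : par root = root)
    (h : ∀ v, v ≠ root → d (par v) < d v) : (parGraph par).IsAcyclic := by
  classical
  intro v0 c0 hc0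
  obtain ⟨v, hv, hmax⟩ := Finset.exists_max_image c0.support.toFinset d
    ⟨v0, by simp⟩
  have hv' : v ∈ c0.support := by simpa using hv
  have hc := hc0.rotate hv'
  have hmem : ∀ w, w ∈ (c0.rotate v hv').support → d w ≤ d v := by
    intro w hw
    apply hmax
    rw [List.mem_toFinset]
    exact (SimpleGraph.Walk.mem_support_rotate_iff _ _ hv').1 hw
  have hpar : ∀ w, (parGraph par).Adj v w → w ∈ (c0.rotate v hv').support → w = par v := by
    intro w hadj hw
    have h1 := hmem w hw
    rw [parGraph_adj] at hadj
    rcases hadj with ⟨hne, e | e⟩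
    · exact e.symm
    · exfalso
      have : w ≠ root := by
        rintro rfl
        exact hne (e.symm.trans hroot)
      have := h w this
      rw [e] at this
      omega
  have h1 := hpar _ ((c0.rotate v hv').adj_snd hc.not_nil)
    ((c0.rotate v hv').getVert_mem_support _)
  have h2 := hpar _ ((c0.rotate v hv').adj_penultimate hc.not_nil).symm
    ((c0.rotate v hv').getVert_mem_support _)
  exact hc.snd_ne_penultimate (h1.trans h2.symm)

lemma parGraph_isTree {V : Type*} (par : V → V) (d : V → ℕ) (root : V)
    (hroot : par root = root)
    (h : ∀ v, v ≠ root → d (par v) < d v) : (parGraph par).IsTree :=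
  ⟨parGraph_connected par d root h, parGraph_acyclic par d root hroot h⟩

/-- A tree decomposition indexed by a rooted tree given by a parent function. -/
lemma hasTreeDecomp_of_par {V ι : Type*} [Finite ι] (G : SimpleGraph V) (k : ℕ)
    (par : ι → ι) (d : ι → ℕ) (root : ι) (hroot : par root = root)
    (h : ∀ v, v ≠ root → d (par v) < d v)
    (bag : ι → Finset V)
    (hedge : ∀ u v : V, G.Adj u v → ∃ i, u ∈ bag i ∧ v ∈ bag i)
    (htop : ∀ v : V, ∃ i, v ∈ bag i ∧ ∀ j, v ∈ bag j → j ≠ i → v ∈ bag (par j) ∧ j ≠ root)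
    (hcard : ∀ i, (bag i).card ≤ k + 1) : HasTreeDecompWidthLE G k := by
  classical
  obtain ⟨N, ⟨e⟩⟩ := Finite.exists_equiv_fin ι
  have hN : N ≠ 0 := by
    rintro rfl
    exact (e root).elim0
  obtain ⟨n, rfl⟩ := Nat.exists_eq_succ_of_ne_zero hN
  have hT := parGraph_isTree par d root hroot h
  let t : SimpleGraph (Fin (n + 1)) := (parGraph par).comap e.symm
  let φ : t ≃g parGraph par := SimpleGraph.Iso.comap e.symm (parGraph par)
  refine ⟨n, t, fun i => bag (e.symm i), φ.isTree_iff.2 hT, ?_, ?_, ?_, fun i => hcard _⟩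
  · intro v
    obtain ⟨i, hi, -⟩ := htop v
    exact ⟨e i, by simpa using hi⟩
  · intro u v huv
    obtain ⟨i, hi⟩ := hedge u v huv
    exact ⟨e i, by simpa using hi⟩
  · intro v
    obtain ⟨top, htopm, hpc⟩ := htop v
    have hm0 : v ∈ bag (e.symm (e top)) := by simpa using htopm
    have key : ∀ n, ∀ j (hj : v ∈ bag (e.symm j)), d (e.symm j) = n →
        (t.induce {i | v ∈ bag (e.symm i)}).Reachable ⟨j, hj⟩ ⟨e top, hm0⟩ := by
      intro n
      induction n using Nat.strong_induction_on with
      | _ n ih =>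
        intro j hj hd
        by_cases hjt : e.symm j = top
        · have : j = e top := by rw [← hjt]; simp
          subst this
          exact SimpleGraph.Reachable.refl _
        · obtain ⟨hp, hnr⟩ := hpc _ hj hjt
          have hlt := h _ hnr
          have hp' : v ∈ bag (e.symm (e (par (e.symm j)))) := by simpa using hp
          have hadj : (t.induce {i | v ∈ bag (e.symm i)}).Adj ⟨j, hj⟩
              ⟨e (par (e.symm j)), hp'⟩ := by
            simp only [t, SimpleGraph.comap_adj, parGraph_adj]
            simp only [Function.Embedding.subtype_apply, Equiv.symm_apply_apply]
            refine ⟨fun hh => ?_, Or.inl trivial⟩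
            rw [← hh] at hlt
            exact lt_irrefl _ hlt
          refine hadj.reachable.trans (ih _ ?_ _ hp' rfl)
          simpa using hd ▸ hlt
    have : Nonempty ({i | v ∈ bag (e.symm i)} : Set (Fin (n+1))) := ⟨⟨e top, hm0⟩⟩
    exact SimpleGraph.Connected.mk
      (fun a b => (key _ a.1 a.2 rfl).trans (key _ b.1 b.2 rfl).symm)

/-- Every tree can be rooted. -/
lemma exists_par {V : Type*} (t : SimpleGraph V) (ht : t.IsTree) (root : V) :
    ∃ (par : V → V) (d : V → ℕ), (∀ v, v ≠ root → d (par v) + 1 = d v) ∧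
      (∀ v, v ≠ root → t.Adj v (par v)) ∧ par root = root ∧
      (∀ v w, t.Adj v w → par v = w ∨ par w = v) := by
  classical
  have hex : ∀ v, v ≠ root → ∃ w, t.Adj v w ∧ t.dist root w + 1 = t.dist root v := by
    intro v hv
    obtain ⟨p, hp⟩ := ht.connected.exists_walk_length_eq_dist v root
    cases p with
    | nil => exact absurd rfl hv
    | cons hadj q =>
      rename_i w
      refine ⟨w, hadj, ?_⟩
      have h1 : t.dist w root ≤ q.length := SimpleGraph.dist_le q
      have h2 := ht.dist_eq_dist_add_one_of_adj root hadj
      rw [SimpleGraph.Walk.length_cons, SimpleGraph.dist_comm] at hp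
      rw [SimpleGraph.dist_comm] at h1
      omega
  have huniq : ∀ v w w', t.Adj v w → t.dist root w + 1 = t.dist root v →
      t.Adj v w' → t.dist root w' + 1 = t.dist root v → w = w' := by
    intro v w w' h1 h2 h3 h4
    obtain ⟨p, hp⟩ := ht.connected.exists_walk_length_eq_dist w root
    obtain ⟨p', hp'⟩ := ht.connected.exists_walk_length_eq_dist w' root
    have e1 : (SimpleGraph.Walk.cons h1 p).IsPath := by
      apply SimpleGraph.Walk.isPath_of_length_eq_dist
      rw [SimpleGraph.Walk.length_cons, hp, SimpleGraph.dist_comm, h2, SimpleGraph.dist_comm]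
    have e2 : (SimpleGraph.Walk.cons h3 p').IsPath := by
      apply SimpleGraph.Walk.isPath_of_length_eq_dist
      rw [SimpleGraph.Walk.length_cons, hp', SimpleGraph.dist_comm, h4, SimpleGraph.dist_comm]
    have := (ht.existsUnique_path v root).unique e1 e2
    simpa using congrArg SimpleGraph.Walk.snd this
  choose! f hf using hex
  refine ⟨fun v => if v = root then root else f v, t.dist root, ?_, ?_, by simp, ?_⟩
  · intro v hv
    simpa [hv] using (hf v hv).2
  · intro v hv
    simpa [hv] using (hf v hv).1
  · intro v w hadj
    rcases ht.dist_eq_dist_add_one_of_adj root hadj with h | h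
    · left
      have hv : v ≠ root := by rintro rfl; simp at h
      simp only [hv, if_false]
      exact huniq v _ _ (hf v hv).1 (hf v hv).2 hadj h.symm
    · right
      have hv : w ≠ root := by rintro rfl; simp at h
      simp only [hv, if_false]
      exact huniq w _ _ (hf w hv).1 (hf w hv).2 hadj.symm h.symm

/-- `A` is a subtree of a rooted tree, with topmost element `top`. -/
def SubTop {I : Type*} (par : I → I) (d : I → ℕ) (A : Set I) (top : I) : Prop :=
  top ∈ A ∧ ∀ i ∈ A, i ≠ top → par i ∈ A ∧ d (par i) + 1 = d i

lemma SubTop.climb {I : Type*} {par : I → I} {d : I → ℕ} {A : Set I} {top : I}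
    (h : SubTop par d A top) : ∀ n, ∀ z ∈ A, d z = n → d top ≤ d z ∧
      (∀ k, k ≤ d z - d top → par^[k] z ∈ A) ∧ par^[d z - d top] z = top := by
  intro n
  induction n with
  | zero =>
    intro z hz hd
    have : z = top := by
      by_contra hne
      have := (h.2 z hz hne).2
      omega
    subst this
    refine ⟨le_rfl, fun k hk => ?_, by simp⟩
    have : k = 0 := by omega
    subst this; simpa using hz
  | succ n ih =>
    intro z hz hd
    by_cases hne : z = top
    · subst hne
      refine ⟨le_rfl, fun k hk => ?_, by simp⟩
      have : k = 0 := by omega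
      subst this; simpa using hz
    · obtain ⟨h1, h2⟩ := h.2 z hz hne
      obtain ⟨i1, i2, i3⟩ := ih (par z) h1 (by omega)
      refine ⟨by omega, fun k hk => ?_, ?_⟩
      · cases k with
        | zero => simpa using hz
        | succ k =>
          rw [Function.iterate_succ_apply]
          exact i2 k (by omega)
      · have : d z - d top = (d (par z) - d top) + 1 := by omega
        rw [this, Function.iterate_succ_apply, i3]

lemma SubTop.mem_of_le {I : Type*} {par : I → I} {d : I → ℕ} {A B : Set I} {a b : I}
    (hA : SubTop par d A a) (hB : SubTop par d B b) (hAB : (A ∩ B).Nonempty)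
    (hle : d b ≤ d a) : a ∈ B := by
  obtain ⟨z, hzA, hzB⟩ := hAB
  obtain ⟨a1, a2, a3⟩ := hA.climb _ z hzA rfl
  obtain ⟨b1, b2, b3⟩ := hB.climb _ z hzB rfl
  rw [← a3]
  exact b2 _ (by omega)

lemma SubTop.union {I : Type*} {par : I → I} {d : I → ℕ} {A B : Set I} {a b : I}
    (hA : SubTop par d A a) (hB : SubTop par d B b) (hAB : (A ∩ B).Nonempty) :
    ∃ c, SubTop par d (A ∪ B) c := by
  wlog hle : d b ≤ d a generalizing A B a b with H
  · rw [Set.union_comm]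
    exact H hB hA (by rwa [Set.inter_comm]) (by omega)
  refine ⟨b, Or.inr hB.1, fun i hi hne => ?_⟩
  have hmem := hA.mem_of_le hB hAB hle
  by_cases hiB : i ∈ B
  · exact ⟨Or.inr (hB.2 i hiB hne).1, (hB.2 i hiB hne).2⟩
  · have hiA : i ∈ A := hi.resolve_right hiB
    have hia : i ≠ a := by rintro rfl; exact hiB hmem
    exact ⟨Or.inl (hA.2 i hiA hia).1, (hA.2 i hiA hia).2⟩

lemma SubTop.of_connected {I : Type*} {t : SimpleGraph I} {par : I → I} {d : I → ℕ} {root : I}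
    (hd : ∀ v, v ≠ root → d (par v) + 1 = d v) (hroot : par root = root)
    (hadj : ∀ v w, t.Adj v w → par v = w ∨ par w = v)
    (A : Set I) (hA : (t.induce A).Connected) : ∃ a, SubTop par d A a := by
  classical
  obtain ⟨⟨x0, hx0⟩⟩ := hA.nonempty
  have hexm : ∃ n, ∃ x ∈ A, d x = n := ⟨_, x0, hx0, rfl⟩
  obtain ⟨top, htop, htd⟩ := Nat.find_spec hexm
  have hmin : ∀ x ∈ A, d top ≤ d x := by
    intro x hx
    rw [htd]
    exact Nat.find_min' hexm ⟨x, hx, rfl⟩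
  have hdle : ∀ v, d (par v) ≤ d v := by
    intro v
    by_cases hv : v = root
    · rw [hv, hroot]
    · have := hd v hv; omega
  have hit : ∀ k v, d (par^[k] v) ≤ d v := by
    intro k
    induction k with
    | zero => intro v; simp
    | succ k ih =>
      intro v
      rw [Function.iterate_succ_apply]
      exact (ih _).trans (hdle v)
  have hrootit : ∀ k, par^[k] root = root := fun k => Function.iterate_fixed hroot k
  refine ⟨top, htop, fun i hi hne => ?_⟩
  have main : par i ∈ A ∧ i ≠ root := by
    by_contra hcon
    -- all of A is below i
    have hdesc : ∀ x : A, (t.induce A).Reachable ⟨i, hi⟩ x → ∃ k, par^[k] x.1 = i := by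
      intro x hx
      obtain ⟨w⟩ := hx.symm
      have : ∀ (x y : A) (w : (t.induce A).Walk x y), (∃ k, par^[k] y.1 = i) →
          ∃ k, par^[k] x.1 = i := by
        intro x y w
        induction w with
        | nil => exact id
        | cons hh q ih =>
          rename_i u v' w'
          intro hy
          obtain ⟨k, hk⟩ := ih hy
          have hh' : t.Adj u.1 v'.1 := by simpa using hh
          rcases hadj _ _ hh' with e | e
          · exact ⟨k + 1, by rw [Function.iterate_succ_apply, e, hk]⟩
          · cases k with
            | zero =>
              exfalso
              simp only [Function.iterate_zero, id] at hk
              apply hcon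
              rw [← hk, e]
              refine ⟨u.2, ?_⟩
              intro hr
              rw [hr, hroot] at e
              exact hh'.ne (e.symm.trans hr.symm)
            | succ k =>
              rw [Function.iterate_succ_apply, e] at hk
              exact ⟨k, hk⟩
      exact this _ _ w ⟨0, rfl⟩
    obtain ⟨k, hk⟩ := hdesc ⟨top, htop⟩ (hA.preconnected _ _)
    simp only at hk
    cases k with
    | zero => exact hne hk.symm
    | succ k =>
      rw [Function.iterate_succ_apply] at hk
      have h1 := hit k (par top)
      rw [hk] at h1
      have h2 := hmin i hi
      by_cases hr : top = root
      · rw [hr, hroot, hrootit] at hk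
        exact hne (hk.symm.trans hr.symm)
      · have := hd top hr
        omega
  exact ⟨main.1, hd i main.2⟩

/-- Connected vertex sets, built one vertex at a time. -/
inductive ConnSet {V : Type*} (G : SimpleGraph V) : Set V → Prop
  | single (v : V) : ConnSet G {v}
  | step (S : Set V) (u v : V) : ConnSet G S → u ∈ S → G.Adj u v → ConnSet G (insert v S)

/-- A graph with a `K₄` minor has no tree decomposition of width two. -/
lemma no_treeDecomp_of_K4 {V : Type*} (G : SimpleGraph V) (S : Fin 4 → Set V)
    (hconn : ∀ k, ConnSet G (S k))
    (hdisj : ∀ k l, k ≠ l → Disjoint (S k) (S l))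
    (htouch : ∀ k l, k < l → ∃ u ∈ S k, ∃ v ∈ S l, G.Adj u v) :
    ¬ HasTreeDecompWidthLE G 2 := by
  classical
  rintro ⟨n, t, bag, htree, -, hedge, hsub, hcard⟩
  obtain ⟨par, d, hd, -, hroot, hadj⟩ := exists_par t htree 0
  let A : Set V → Set (Fin (n + 1)) := fun S => {i | ∃ v ∈ S, v ∈ bag i}
  have hA : ∀ T, ConnSet G T → ∃ a, SubTop par d (A T) a := by
    intro T hT
    have hs : ∀ v, A {v} = {i | v ∈ bag i} := by
      intro v; ext i; simp [A]
    induction hT with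
    | single v =>
      rw [hs]
      exact SubTop.of_connected hd hroot hadj _ (hsub v)
    | step S u v _ hu huv ih =>
      obtain ⟨a, ha⟩ := ih
      obtain ⟨b, hb⟩ := SubTop.of_connected hd hroot hadj _ (hsub v)
      have : A (insert v S) = {i | v ∈ bag i} ∪ A S := by
        ext i; simp [A]
      rw [this]
      apply hb.union ha
      obtain ⟨i, h1, h2⟩ := hedge u v huv
      exact ⟨i, h2, u, hu, h1⟩
  choose top htop using fun k => hA (S k) (hconn k)
  obtain ⟨k, -, hk⟩ := Finset.exists_max_image (Finset.univ : Finset (Fin 4))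
    (fun k => d (top k)) ⟨0, Finset.mem_univ _⟩
  have hall : ∀ l, top k ∈ A (S l) := by
    intro l
    by_cases hkl : k = l
    · subst hkl; exact (htop k).1
    · apply (htop k).mem_of_le (htop l) _ (hk l (Finset.mem_univ _))
      rcases lt_or_gt_of_ne hkl with h | h
      · obtain ⟨u, hu, v, hv, huv⟩ := htouch k l h
        obtain ⟨i, h1, h2⟩ := hedge u v huv
        exact ⟨i, ⟨u, hu, h1⟩, ⟨v, hv, h2⟩⟩
      · obtain ⟨u, hu, v, hv, huv⟩ := htouch l k h
        obtain ⟨i, h1, h2⟩ := hedge u v huv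
        exact ⟨i, ⟨v, hv, h2⟩, ⟨u, hu, h1⟩⟩
  choose x hxS hxb using hall
  have hinj : Function.Injective x := by
    intro a b hab
    by_contra hne
    exact Set.disjoint_left.1 (hdisj a b hne) (hxS a) (hab ▸ hxS b)
  have h4 : (Finset.univ.image x).card = 4 := by
    rw [Finset.card_image_of_injective _ hinj]; simp
  have hle : (Finset.univ.image x).card ≤ (bag (top k)).card := by
    apply Finset.card_le_card
    intro y hy
    obtain ⟨l, -, rfl⟩ := Finset.mem_image.1 hy
    exact hxb l
  have := hcard (top k)
  omega

/-- Vertices of the tree: a backbone, with one balanced four-leaf subtree per block. -/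
inductive Vt (n : ℕ) : Type
  | p (j : Fin (n + 2)) : Vt n
  | r (i : Fin n) : Vt n
  | u (i : Fin n) (b : Bool) : Vt n
  | a (i : Fin n) (b c : Bool) : Vt n

namespace Vt

variable {n : ℕ}

instance : Finite (Vt n) := by
  let f : Fin (n + 2) ⊕ Fin n ⊕ (Fin n × Bool) ⊕ (Fin n × Bool × Bool) → Vt n
    | Sum.inl j => p j
    | Sum.inr (Sum.inl i) => r i
    | Sum.inr (Sum.inr (Sum.inl x)) => u x.1 x.2
    | Sum.inr (Sum.inr (Sum.inr x)) => a x.1 x.2.1 x.2.2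
  refine Finite.of_surjective f ?_
  rintro (j | i | ⟨i, b⟩ | ⟨i, b, c⟩)
  · exact ⟨Sum.inl j, rfl⟩
  · exact ⟨Sum.inr (Sum.inl i), rfl⟩
  · exact ⟨Sum.inr (Sum.inr (Sum.inl (i, b))), rfl⟩
  · exact ⟨Sum.inr (Sum.inr (Sum.inr (i, b, c))), rfl⟩

/-- The parent of a vertex. -/
def par : Vt n → Vt n
  | p j => p ⟨j.1 - 1, by omega⟩
  | r i => p ⟨i.1 + 1, by omega⟩
  | u i _ => r i
  | a i b _ => u i b

/-- The depth of a vertex. -/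
def dep : Vt n → ℕ
  | p j => j.1
  | r i => i.1 + 2
  | u i _ => i.1 + 3
  | a i _ _ => i.1 + 4

lemma par_root : par (p 0 : Vt n) = p 0 := rfl

lemma dep_par (v : Vt n) (hv : v ≠ p 0) : dep (par v) < dep v := by
  cases v with
  | p j =>
    have : j.1 ≠ 0 := fun h => hv (by congr 1; exact Fin.ext h)
    simp only [par, dep]; omega
  | r i => simp only [par, dep]; omega
  | u i b => simp only [par, dep]; omega
  | a i b c => simp only [par, dep]; omega

/-- The tree. -/
def G (n : ℕ) : SimpleGraph (Vt n) := parGraph par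

/-- Labels: two labels for the ends of the backbone, and four per block. -/
abbrev Lab (n : ℕ) : Type := Bool ⊕ (Fin n × Bool × Bool)

/-- Leaf labelling of the first tree. -/
def leaf1 : Lab n → Vt n
  | Sum.inl false => p 0
  | Sum.inl true => p (Fin.last (n + 1))
  | Sum.inr x => a x.1 x.2.1 x.2.2

/-- Leaf labelling of the second tree. -/
def leaf2 : Lab n → Vt n
  | Sum.inl false => p 0
  | Sum.inl true => p (Fin.last (n + 1))
  | Sum.inr x => a x.1 x.2.2 x.2.1

/-- Exchanging the two middle labels of each block. -/
def swapLab : Lab n → Lab n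
  | Sum.inl b => Sum.inl b
  | Sum.inr x => Sum.inr (x.1, x.2.2, x.2.1)

lemma swapLab_swapLab (x : Lab n) : swapLab (swapLab x) = x := by
  rcases x with b | ⟨i, b, c⟩ <;> rfl

lemma leaf2_eq (x : Lab n) : leaf2 x = leaf1 (swapLab x) := by
  rcases x with (_ | _) | ⟨i, b, c⟩ <;> rfl

lemma leaf1_inj : Function.Injective (leaf1 : Lab n → Vt n) := by
  have h0 : (0 : Fin (n + 2)) ≠ Fin.last (n + 1) := by
    intro h
    have := congrArg Fin.val h
    simp at this
  rintro ((_ | _) | ⟨i, b, c⟩) ((_ | _) | ⟨i', b', c'⟩) h <;>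
    simp_all [leaf1]

lemma leaf2_inj : Function.Injective (leaf2 : Lab n → Vt n) := by
  intro x y h
  rw [leaf2_eq, leaf2_eq] at h
  have := congrArg swapLab (leaf1_inj h)
  rwa [swapLab_swapLab, swapLab_swapLab] at this

lemma adj_iff (v w : Vt n) : (G n).Adj v w ↔ v ≠ w ∧ (par v = w ∨ par w = v) :=
  parGraph_adj _ _ _

lemma adj_par (v : Vt n) (hv : v ≠ p 0) : (G n).Adj v (par v) := by
  rw [adj_iff]
  refine ⟨fun h => ?_, Or.inl rfl⟩
  have := dep_par v hv
  rw [← h] at this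
  exact lt_irrefl _ this

lemma nbr_a (i : Fin n) (b c : Bool) : (G n).neighborSet (a i b c) = {u i b} := by
  ext w
  simp only [SimpleGraph.mem_neighborSet, adj_iff, Set.mem_singleton_iff]
  constructor
  · rintro ⟨-, h | h⟩
    · exact h.symm
    · cases w <;> simp [par] at h
  · rintro rfl
    simp [par]

lemma nbr_u (i : Fin n) (b : Bool) :
    (G n).neighborSet (u i b) = {r i, a i b false, a i b true} := by
  ext w
  simp only [SimpleGraph.mem_neighborSet, adj_iff, Set.mem_insert_iff, Set.mem_singleton_iff]
  constructor
  · rintro ⟨-, h | h⟩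
    · exact Or.inl h.symm
    · cases w with
      | a i' b' c' => cases c' <;> simp_all [par]
      | _ => simp [par] at h
  · rintro (rfl | rfl | rfl) <;> simp [par]

lemma nbr_r (i : Fin n) :
    (G n).neighborSet (r i) = {p ⟨i.1 + 1, by omega⟩, u i false, u i true} := by
  ext w
  simp only [SimpleGraph.mem_neighborSet, adj_iff, Set.mem_insert_iff, Set.mem_singleton_iff]
  constructor
  · rintro ⟨-, h | h⟩
    · exact Or.inl h.symm
    · cases w with
      | u i' b' => cases b' <;> simp_all [par]
      | _ => simp [par] at h
  · rintro (rfl | rfl | rfl) <;> simp [par]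

lemma nbr_p (i : Fin n) :
    (G n).neighborSet (p ⟨i.1 + 1, by omega⟩) =
      {p ⟨i.1, by omega⟩, p ⟨i.1 + 2, by omega⟩, r i} := by
  ext w
  simp only [SimpleGraph.mem_neighborSet, adj_iff, Set.mem_insert_iff, Set.mem_singleton_iff]
  constructor
  · rintro ⟨hne, h | h⟩
    · exact Or.inl h.symm
    · cases w with
      | p j =>
        simp only [par, p.injEq, Fin.mk.injEq, Fin.ext_iff, ne_eq] at h ⊢
        simp only [reduceCtorEq, or_false]
        omega
      | r j =>
        simp only [par, p.injEq, Fin.mk.injEq] at h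
        right; right
        congr 1
        apply Fin.ext
        omega
      | _ => simp [par] at h
  · rintro (rfl | rfl | rfl) <;> simp [par]

lemma nbr_p0 (hn : 0 < n) : (G n).neighborSet (p 0) = {p ⟨1, by omega⟩} := by
  ext w
  simp only [SimpleGraph.mem_neighborSet, adj_iff, Set.mem_singleton_iff]
  constructor
  · rintro ⟨hne, h | h⟩
    · exact absurd h hne
    · cases w with
      | p j =>
        simp only [par, p.injEq, Fin.ext_iff, ne_eq, Fin.val_zero] at h hne ⊢
        omega
      | r j =>
        simp only [par, p.injEq, Fin.ext_iff, Fin.val_zero] at h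
        omega
      | _ => simp [par] at h
  · rintro rfl
    simp [par, Fin.ext_iff]

lemma nbr_plast : (G n).neighborSet (p (Fin.last (n + 1))) = {p ⟨n, by omega⟩} := by
  ext w
  simp only [SimpleGraph.mem_neighborSet, adj_iff, Set.mem_singleton_iff]
  constructor
  · rintro ⟨hne, h | h⟩
    · exact h.symm
    · cases w with
      | p j =>
        simp only [par, p.injEq, Fin.ext_iff, ne_eq, Fin.val_last] at h hne ⊢
        omega
      | r j =>
        simp only [par, p.injEq, Fin.ext_iff, Fin.val_last] at h
        omega
      | _ => simp [par] at h
  · rintro rfl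
    simp [par, Fin.ext_iff]

lemma ncard_three {α : Type*} {x y z : α} (h1 : x ≠ y) (h2 : x ≠ z) (h3 : y ≠ z) :
    ({x, y, z} : Set α).ncard = 3 := Set.ncard_eq_three.2 ⟨x, y, z, h1, h2, h3, rfl⟩

lemma leaf1_deg (hn : 0 < n) (x : Lab n) : ((G n).neighborSet (leaf1 x)).ncard = 1 := by
  rcases x with (_ | _) | ⟨i, b, c⟩
  · simp only [leaf1]; rw [nbr_p0 hn, Set.ncard_singleton]
  · simp only [leaf1]; rw [nbr_plast, Set.ncard_singleton]
  · simp only [leaf1]; rw [nbr_a, Set.ncard_singleton]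

lemma internal1 (v : Vt n) (hv : ∀ x : Lab n, leaf1 x ≠ v) :
    ((G n).neighborSet v).ncard = 3 := by
  cases v with
  | a i b c => exact absurd rfl (hv (Sum.inr (i, b, c)))
  | u i b => rw [nbr_u]; exact ncard_three (by simp) (by simp) (by simp)
  | r i => rw [nbr_r]; exact ncard_three (by simp) (by simp) (by simp)
  | p j =>
    have h0 : j.1 ≠ 0 := by
      intro h
      apply hv (Sum.inl false)
      simp only [leaf1]; congr 1; exact Fin.ext h.symm
    have h1 : j.1 ≠ n + 1 := by
      intro h
      apply hv (Sum.inl true)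
      simp only [leaf1]; congr 1; exact Fin.ext h.symm
    obtain ⟨i, rfl⟩ : ∃ i : Fin n, j = ⟨i.1 + 1, by omega⟩ :=
      ⟨⟨j.1 - 1, by omega⟩, Fin.ext (by simp; omega)⟩
    rw [nbr_p]
    exact ncard_three (by simp) (by simp) (by simp)

/-- The first tree. -/
def T1 (hn : 0 < n) : PhyloTree (Vt n) (Lab n) where
  graph := G n
  finite := inferInstance
  connected := parGraph_connected par dep (p 0) dep_par
  leaf := leaf1
  leaf_inj := leaf1_inj
  leaf_deg := leaf1_deg hn
  internal_deg := internal1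
  acyclic := parGraph_acyclic par dep (p 0) par_root dep_par

/-- The second tree. -/
def T2 (hn : 0 < n) : PhyloTree (Vt n) (Lab n) where
  graph := G n
  finite := inferInstance
  connected := parGraph_connected par dep (p 0) dep_par
  leaf := leaf2
  leaf_inj := leaf2_inj
  leaf_deg := fun x => by rw [leaf2_eq]; exact leaf1_deg hn _
  internal_deg := fun v hv => internal1 v (fun x hx => hv (swapLab x) (by
    rw [leaf2_eq, swapLab_swapLab, hx]))
  acyclic := parGraph_acyclic par dep (p 0) par_root dep_par

/-! ### Parsimony scores -/

lemma parsimonyScore_le_edges {V X C : Type*} [Finite V] (H : SimpleGraph V) (l : X → V)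
    (f : X → C) : parsimonyScore H l f ≤ H.edgeSet.ncard := by
  unfold parsimonyScore
  rcases Set.eq_empty_or_nonempty {m | ∃ g : V → C, (∀ x, g (l x) = f x) ∧
    {e | e ∈ H.edgeSet ∧ ∃ u v : V, e = s(u, v) ∧ g u ≠ g v}.ncard = m} with h | ⟨m, hm⟩
  · rw [h]; simp
  · refine (Nat.sInf_le hm).trans ?_
    obtain ⟨g, -, rfl⟩ := hm
    exact Set.ncard_le_ncard (fun e he => he.1) (Set.toFinite _)

/-- The character. -/
def chr : Lab n → Fin 2
  | Sum.inl _ => 0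
  | Sum.inr x => if x.2.1 then 1 else 0

/-- An optimal extension to the first tree. -/
def ext1 : Vt n → Fin 2
  | p _ => 0
  | r _ => 0
  | u _ b => if b then 1 else 0
  | a _ b _ => if b then 1 else 0

lemma score1 : parsimonyScore (G n) leaf1 (chr : Lab n → Fin 2) ≤ n := by
  have hle : parsimonyScore (G n) leaf1 (chr : Lab n → Fin 2) ≤
      {e | e ∈ (G n).edgeSet ∧ ∃ u v : Vt n, e = s(u, v) ∧ ext1 u ≠ ext1 v}.ncard := by
    apply Nat.sInf_le
    refine ⟨ext1, ?_, rfl⟩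
    rintro ((_ | _) | ⟨i, b, c⟩) <;> rfl
  refine hle.trans ?_
  · have hsub : {e | e ∈ (G n).edgeSet ∧ ∃ u v : Vt n, e = s(u, v) ∧ ext1 u ≠ ext1 v} ⊆
        Set.range (fun i : Fin n => s(u i true, r i)) := by
      rintro e ⟨he, v, w, rfl, hvw⟩
      rw [SimpleGraph.mem_edgeSet, adj_iff] at he
      have key : ∀ v : Vt n, ext1 v ≠ ext1 (par v) →
          s(v, par v) ∈ Set.range (fun i : Fin n => s(u i true, r i)) := by
        intro v hv
        cases v with
        | p j => exact absurd rfl hv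
        | r i => exact absurd rfl hv
        | a i b c => exact absurd rfl hv
        | u i b =>
          cases b with
          | false => exact absurd rfl hv
          | true => exact ⟨i, rfl⟩
      rcases he with ⟨-, h | h⟩
      · rw [← h] at hvw ⊢
        exact key v hvw
      · rw [← h] at hvw ⊢
        rw [Sym2.eq_swap]
        exact key w hvw.symm
    refine (Set.ncard_le_ncard hsub (Set.toFinite _)).trans ?_
    rw [← Set.image_univ]
    refine (Set.ncard_image_le (Set.toFinite _)).trans ?_
    rw [Set.ncard_univ]
    simp

lemma score2 : 2 * n ≤ parsimonyScore (G n) leaf2 (chr : Lab n → Fin 2) := by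
  classical
  unfold parsimonyScore
  apply le_csInf
  · exact ⟨_, Function.extend leaf2 chr (fun _ => 0),
      fun x => leaf2_inj.extend_apply _ _ _, rfl⟩
  · rintro m ⟨g, hg, rfl⟩
    have hex : ∀ x : Fin n × Bool, ∃ b : Bool, g (a x.1 x.2 b) ≠ g (u x.1 x.2) := by
      intro x
      by_contra! hcon
      have h0 := hg (Sum.inr (x.1, false, x.2))
      have h1 := hg (Sum.inr (x.1, true, x.2))
      simp only [leaf2, chr] at h0 h1
      rw [hcon] at h0 h1
      rw [h0] at h1
      simp at h1
    choose β hβ using hex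
    have hinj : Function.Injective
        (fun x : Fin n × Bool => s(a x.1 x.2 (β x), u x.1 x.2)) := by
      rintro ⟨i, b⟩ ⟨i', b'⟩ h
      simp at h
      ext <;> simp [h]
    have hcard : (Set.range (fun x : Fin n × Bool =>
        s(a x.1 x.2 (β x), u x.1 x.2))).ncard = 2 * n := by
      rw [← Set.image_univ, Set.ncard_image_of_injective _ hinj, Set.ncard_univ]
      simp [mul_comm]
    rw [← hcard]
    refine Set.ncard_le_ncard ?_ (Set.toFinite _)
    rintro e ⟨x, rfl⟩
    refine ⟨?_, _, _, rfl, hβ x⟩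
    rw [SimpleGraph.mem_edgeSet]
    exact adj_par (a x.1 x.2 (β x)) (by simp)

lemma le_dMP (hn : 0 < n) : n ≤ dMP (T1 hn) (T2 hn) := by
  have h1 : parsimonyScore (T1 hn).graph (T1 hn).leaf (chr : Lab n → Fin 2) ≤ n := score1
  have h2 : 2 * n ≤ parsimonyScore (T2 hn).graph (T2 hn).leaf (chr : Lab n → Fin 2) := score2
  have hs : Function.Surjective (chr : Lab n → Fin 2) := by
    intro k
    fin_cases k
    · exact ⟨Sum.inl false, rfl⟩
    · exact ⟨Sum.inr (⟨0, hn⟩, true, true), rfl⟩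
  refine le_trans ?_ (le_csSup ?_ ⟨2, chr, hs, rfl⟩)
  · refine le_trans ?_ (le_max_right _ _)
    omega
  · refine ⟨(G n).edgeSet.ncard, ?_⟩
    rintro m ⟨k, f, -, rfl⟩
    have e1 : parsimonyScore (T1 hn).graph (T1 hn).leaf f ≤ (G n).edgeSet.ncard :=
      parsimonyScore_le_edges _ _ _
    have e2 : parsimonyScore (T2 hn).graph (T2 hn).leaf f ≤ (G n).edgeSet.ncard :=
      parsimonyScore_le_edges _ _ _
    apply max_le <;> omega

end Vt

namespace Vt

variable {n : ℕ}

/-- Explicit form of the identification map. -/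
noncomputable def nf : Vt n ⊕ Vt n → Vt n ⊕ Vt n
  | Sum.inl v => Sum.inl v
  | Sum.inr (p j) => if j.1 = 0 ∨ j.1 = n + 1 then Sum.inl (p j) else Sum.inr (p j)
  | Sum.inr (r i) => Sum.inr (r i)
  | Sum.inr (u i b) => Sum.inr (u i b)
  | Sum.inr (a i b c) => Sum.inl (a i c b)

lemma merge_leaf (x : Lab n) :
    mergeMap leaf1 leaf2 (Sum.inr (leaf2 x)) = Sum.inl (leaf1 x) := by
  have h : ∃ y : Lab n, leaf2 y = leaf2 x := ⟨x, rfl⟩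
  simp only [mergeMap, h, dif_pos]
  rw [leaf2_inj h.choose_spec]

lemma merge_internal (w : Vt n) (h : ∀ x : Lab n, leaf2 x ≠ w) :
    mergeMap leaf1 leaf2 (Sum.inr w) = Sum.inr w := by
  simp [mergeMap, h]

lemma merge_eq (x : Vt n ⊕ Vt n) : mergeMap leaf1 leaf2 x = nf x := by
  rcases x with v | v
  · rfl
  · cases v with
    | p j =>
      simp only [nf]
      split_ifs with h
      · rcases h with h | h
        · have : j = 0 := Fin.ext h
          subst this
          exact merge_leaf (Sum.inl false)
        · have : j = Fin.last (n + 1) := Fin.ext h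
          subst this
          exact merge_leaf (Sum.inl true)
      · apply merge_internal
        rintro ((_ | _) | ⟨i, b, c⟩) hx
        · simp only [leaf2, p.injEq] at hx
          subst hx
          simp at h
        · simp only [leaf2, p.injEq] at hx
          subst hx
          simp at h
        · simp [leaf2] at hx
    | r i =>
      apply merge_internal
      rintro ((_ | _) | ⟨i, b, c⟩) <;> simp [leaf2]
    | u i b =>
      apply merge_internal
      rintro ((_ | _) | ⟨i, b, c⟩) <;> simp [leaf2]
    | a i b c => exact merge_leaf (Sum.inr (i, c, b))

/-- The display graph of the two trees. -/
noncomputable abbrev DG (n : ℕ) :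
    SimpleGraph (DisplayVertex (leaf1 : Lab n → Vt n) (leaf2 : Lab n → Vt n)) :=
  displayGraph (G n) leaf1 (G n) leaf2

/-- The vertex of the display graph given by a vertex of one of the trees. -/
noncomputable abbrev D (x : Vt n ⊕ Vt n) :
    DisplayVertex (leaf1 : Lab n → Vt n) (leaf2 : Lab n → Vt n) := toDisplay leaf1 leaf2 x

lemma D_val (x : Vt n ⊕ Vt n) : (D x).1 = nf x := merge_eq x

lemma D_eq_iff (x y : Vt n ⊕ Vt n) : D x = D y ↔ nf x = nf y := by
  rw [← D_val, ← D_val]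
  exact Subtype.ext_iff

lemma DG_adj_inl (v : Vt n) (hv : v ≠ p 0) : (DG n).Adj (D (Sum.inl v)) (D (Sum.inl (par v))) := by
  have hadj := adj_par v hv
  rw [DG, displayGraph, SimpleGraph.fromRel_adj]
  refine ⟨?_, Or.inl (Or.inl ⟨v, par v, hadj, rfl, rfl⟩)⟩
  rw [Ne, D_eq_iff]
  simp only [nf, Sum.inl.injEq]
  exact hadj.ne

lemma DG_adj_inr (v : Vt n) (hv : v ≠ p 0) (hne : nf (Sum.inr v) ≠ nf (Sum.inr (par v))) :
    (DG n).Adj (D (Sum.inr v)) (D (Sum.inr (par v))) := by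
  have hadj := adj_par v hv
  rw [DG, displayGraph, SimpleGraph.fromRel_adj]
  refine ⟨?_, Or.inl (Or.inr ⟨v, par v, hadj, rfl, rfl⟩)⟩
  rwa [Ne, D_eq_iff]

/-! ### The tree decomposition of width three -/

/-- Nodes of the tree decomposition. -/
inductive Ix (n : ℕ) : Type
  | e (j : Fin (n + 1)) : Ix n
  | c (i : Fin n) : Ix n
  | m (i : Fin n) : Ix n
  | h (i : Fin n) (b : Bool) : Ix n
  | l (i : Fin n) (b c : Bool) : Ix n

instance : Finite (Ix n) := by
  let f : Fin (n + 1) ⊕ Fin n ⊕ Fin n ⊕ (Fin n × Bool) ⊕ (Fin n × Bool × Bool) → Ix n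
    | Sum.inl j => Ix.e j
    | Sum.inr (Sum.inl i) => Ix.c i
    | Sum.inr (Sum.inr (Sum.inl i)) => Ix.m i
    | Sum.inr (Sum.inr (Sum.inr (Sum.inl x))) => Ix.h x.1 x.2
    | Sum.inr (Sum.inr (Sum.inr (Sum.inr x))) => Ix.l x.1 x.2.1 x.2.2
  refine Finite.of_surjective f ?_
  rintro (j | i | i | ⟨i, b⟩ | ⟨i, b, c⟩)
  · exact ⟨Sum.inl j, rfl⟩
  · exact ⟨Sum.inr (Sum.inl i), rfl⟩
  · exact ⟨Sum.inr (Sum.inr (Sum.inl i)), rfl⟩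
  · exact ⟨Sum.inr (Sum.inr (Sum.inr (Sum.inl (i, b)))), rfl⟩
  · exact ⟨Sum.inr (Sum.inr (Sum.inr (Sum.inr (i, b, c)))), rfl⟩

/-- Parent of a node of the decomposition. -/
def ipar : Ix n → Ix n
  | Ix.e j => Ix.e ⟨j.1 - 1, by omega⟩
  | Ix.c i => Ix.e ⟨i.1, by omega⟩
  | Ix.m i => Ix.c i
  | Ix.h i _ => Ix.m i
  | Ix.l i b _ => Ix.h i b

/-- Depth of a node of the decomposition. -/
def idep : Ix n → ℕ
  | Ix.e j => j.1
  | Ix.c i => i.1 + 1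
  | Ix.m i => i.1 + 2
  | Ix.h i _ => i.1 + 3
  | Ix.l i _ _ => i.1 + 4

lemma idep_ipar (v : Ix n) (hv : v ≠ Ix.e 0) : idep (ipar v) < idep v := by
  cases v with
  | e j =>
    have : j.1 ≠ 0 := fun h => hv (by congr 1; exact Fin.ext h)
    simp only [ipar, idep]; omega
  | _ => simp only [ipar, idep]; omega

open Classical in
/-- The bags, as sets of tree vertices. -/
noncomputable def bag0 : Ix n → Finset (Vt n ⊕ Vt n)
  | Ix.e j => {Sum.inl (p ⟨j.1, by omega⟩), Sum.inl (p ⟨j.1 + 1, by omega⟩),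
      nf (Sum.inr (p ⟨j.1, by omega⟩)), nf (Sum.inr (p ⟨j.1 + 1, by omega⟩))}
  | Ix.c i => {Sum.inl (p ⟨i.1 + 1, by omega⟩), Sum.inr (p ⟨i.1 + 1, by omega⟩),
      Sum.inl (r i), Sum.inr (r i)}
  | Ix.m i => {Sum.inr (u i false), Sum.inr (u i true), Sum.inl (r i), Sum.inr (r i)}
  | Ix.h i b => {Sum.inr (u i false), Sum.inr (u i true), Sum.inl (r i), Sum.inl (u i b)}
  | Ix.l i b c => {Sum.inl (a i b c), Sum.inl (u i b), Sum.inr (u i c)}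

lemma bag0_card (i : Ix n) : (bag0 i).card ≤ 3 + 1 := by
  classical
  cases i with
  | l i b c => exact Finset.card_le_three.trans (by norm_num)
  | _ => exact Finset.card_le_four

lemma bag0_edge_inl (v : Vt n) (hv : v ≠ p 0) :
    ∃ i : Ix n, nf (Sum.inl v) ∈ bag0 i ∧ nf (Sum.inl (par v)) ∈ bag0 i := by
  cases v with
  | p j =>
    have h0 : j.1 ≠ 0 := fun h => hv (by congr 1; exact Fin.ext h)
    refine ⟨Ix.e ⟨j.1 - 1, by omega⟩, ?_, ?_⟩
    · have : j = ⟨j.1 - 1 + 1, by omega⟩ := Fin.ext (by simp; omega)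
      rw [this]
      simp [nf, bag0]
    · simp [nf, bag0, par]
  | r i => exact ⟨Ix.c i, by simp [nf, bag0], by simp [nf, bag0, par]⟩
  | u i b => exact ⟨Ix.h i b, by simp [nf, bag0], by simp [nf, bag0, par]⟩
  | a i b c => exact ⟨Ix.l i b c, by simp [nf, bag0], by simp [nf, bag0, par]⟩

lemma bag0_edge_inr (v : Vt n) (hv : v ≠ p 0) :
    ∃ i : Ix n, nf (Sum.inr v) ∈ bag0 i ∧ nf (Sum.inr (par v)) ∈ bag0 i := by
  cases v with
  | p j =>
    have h0 : j.1 ≠ 0 := fun h => hv (by congr 1; exact Fin.ext h)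
    refine ⟨Ix.e ⟨j.1 - 1, by omega⟩, ?_, ?_⟩
    · have : j = ⟨j.1 - 1 + 1, by omega⟩ := Fin.ext (by simp; omega)
      rw [this]
      simp only [bag0, Finset.mem_insert, Finset.mem_singleton]
      simp
    · simp only [bag0, par, Finset.mem_insert, Finset.mem_singleton]
      simp
  | r i =>
    refine ⟨Ix.c i, by simp [nf, bag0], ?_⟩
    have h1 : i.1 ≠ n := by omega
    simp [nf, bag0, par, h1]
  | u i b => exact ⟨Ix.m i, by cases b <;> simp [nf, bag0], by simp [nf, bag0, par]⟩
  | a i c b => exact ⟨Ix.l i b c, by simp [nf, bag0], by simp [nf, bag0, par]⟩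

lemma mem_e_inl (j : Fin (n + 2)) (k : Fin (n + 1)) :
    Sum.inl (p j) ∈ bag0 (Ix.e k) ↔ j.1 = k.1 ∨ j.1 = k.1 + 1 := by
  simp only [bag0, Finset.mem_insert, Finset.mem_singleton, nf]
  constructor
  · intro h
    split_ifs at h <;> simp [Fin.ext_iff] at h <;> omega
  · rintro (h | h)
    · left; simp [Fin.ext_iff, h]
    · right; left; simp [Fin.ext_iff, h]

lemma mem_e_inr (j : Fin (n + 2)) (hj : ¬ (j.1 = 0 ∨ j.1 = n + 1)) (k : Fin (n + 1)) :
    Sum.inr (p j) ∈ bag0 (Ix.e k) ↔ j.1 = k.1 ∨ j.1 = k.1 + 1 := by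
  have hnf : nf (Sum.inr (p j)) = Sum.inr (p j) := by simp only [nf, if_neg hj]
  simp only [bag0, Finset.mem_insert, Finset.mem_singleton]
  constructor
  · intro h
    simp only [nf] at h
    split_ifs at h <;> simp [Fin.ext_iff] at h <;> omega
  · rintro (h | h)
    · have : (⟨k.1, by omega⟩ : Fin (n + 2)) = j := Fin.ext h.symm
      rw [this, hnf]; simp
    · have : (⟨k.1 + 1, by omega⟩ : Fin (n + 2)) = j := Fin.ext h.symm
      rw [this, hnf]; simp

lemma bag0_top (x : Vt n ⊕ Vt n) (hx : nf x = x) : ∃ i : Ix n, x ∈ bag0 i ∧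
    ∀ j, x ∈ bag0 j → j ≠ i → x ∈ bag0 (ipar j) ∧ j ≠ Ix.e 0 := by
  rcases x with (j | i | ⟨i, b⟩ | ⟨i, b, c⟩) | (j | i | ⟨i, b⟩ | ⟨i, b, c⟩)
  · refine ⟨Ix.e ⟨j.1 - 1, by omega⟩, ?_, ?_⟩
    · rw [mem_e_inl]; simp only; omega
    · rintro (k | k | k | ⟨k, b⟩ | ⟨k, b, c⟩) hk hne
      · rw [mem_e_inl] at hk
        simp only [ne_eq, Ix.e.injEq, Fin.ext_iff] at hne
        simp only [ipar, mem_e_inl, ne_eq, Ix.e.injEq, Fin.ext_iff, Fin.val_zero]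
        omega
      · simp [bag0, Fin.ext_iff] at hk
        simp only [ipar, mem_e_inl]
        simp
        omega
      · simp [bag0] at hk
      · simp [bag0] at hk
      · simp [bag0] at hk
  · refine ⟨Ix.c i, by simp [bag0], ?_⟩
    rintro (k | k | k | ⟨k, b⟩ | ⟨k, b, c⟩) hk hne
    · simp only [bag0, nf] at hk
      split_ifs at hk <;> simp at hk
    all_goals simp_all [bag0, ipar]
  · refine ⟨Ix.h i b, by simp [bag0], ?_⟩
    rintro (k | k | k | ⟨k, b'⟩ | ⟨k, b', c'⟩) hk hne
    · simp only [bag0, nf] at hk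
      split_ifs at hk <;> simp at hk
    all_goals simp_all [bag0, ipar]
  · refine ⟨Ix.l i b c, by simp [bag0], ?_⟩
    rintro (k | k | k | ⟨k, b'⟩ | ⟨k, b', c'⟩) hk hne
    · simp only [bag0, nf] at hk
      split_ifs at hk <;> simp at hk
    all_goals simp_all [bag0, ipar]
  · have hj : ¬ (j.1 = 0 ∨ j.1 = n + 1) := by
      intro h
      rw [nf, if_pos h] at hx
      simp at hx
    have mem_e := mem_e_inr j hj
    refine ⟨Ix.e ⟨j.1 - 1, by omega⟩, ?_, ?_⟩
    · rw [mem_e]; simp only; omega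
    · rintro (k | k | k | ⟨k, b⟩ | ⟨k, b, c⟩) hk hne
      · rw [mem_e] at hk
        simp only [ne_eq, Ix.e.injEq, Fin.ext_iff] at hne
        simp only [ipar, mem_e, ne_eq, Ix.e.injEq, Fin.ext_iff, Fin.val_zero]
        omega
      · simp [bag0, Fin.ext_iff] at hk
        simp only [ipar, mem_e]
        simp
        omega
      · simp [bag0] at hk
      · simp [bag0] at hk
      · simp [bag0] at hk
  · refine ⟨Ix.c i, by simp [bag0], ?_⟩
    rintro (k | k | k | ⟨k, b⟩ | ⟨k, b, c⟩) hk hne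
    · simp only [bag0, nf] at hk
      split_ifs at hk <;> simp at hk
    all_goals simp_all [bag0, ipar]
  · refine ⟨Ix.m i, by cases b <;> simp [bag0], ?_⟩
    rintro (k | k | k | ⟨k, b'⟩ | ⟨k, b', c'⟩) hk hne
    · simp only [bag0, nf] at hk
      split_ifs at hk <;> simp at hk
    all_goals cases b <;> simp_all [bag0, ipar]
  · simp [nf] at hx

lemma hasTD : HasTreeDecompWidthLE (DG n) 3 := by
  classical
  let bag : Ix n → Finset (DisplayVertex (leaf1 : Lab n → Vt n) (leaf2 : Lab n → Vt n)) :=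
    fun i => (bag0 i).preimage Subtype.val Subtype.val_injective.injOn
  have hbag : ∀ x i, x ∈ bag i ↔ x.1 ∈ bag0 i := fun x i => Finset.mem_preimage
  refine hasTreeDecomp_of_par (DG n) 3 ipar idep (Ix.e 0) rfl idep_ipar bag ?_ ?_ ?_
  · have key : ∀ x y : DisplayVertex (leaf1 : Lab n → Vt n) (leaf2 : Lab n → Vt n),
        ((∃ u v : Vt n, (G n).Adj u v ∧ x = D (Sum.inl u) ∧ y = D (Sum.inl v)) ∨
        (∃ u v : Vt n, (G n).Adj u v ∧ x = D (Sum.inr u) ∧ y = D (Sum.inr v))) →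
        ∃ i, x ∈ bag i ∧ y ∈ bag i := by
      have hroot : ∀ v w : Vt n, v ≠ w → par v = w → v ≠ p 0 := by
        rintro v w hne h rfl
        exact hne h
      rintro x y (⟨v, w, hadj, rfl, rfl⟩ | ⟨v, w, hadj, rfl, rfl⟩) <;>
        simp only [hbag, D_val] <;> rw [adj_iff] at hadj <;>
        rcases hadj with ⟨hne, h | h⟩
      · obtain ⟨i, h1, h2⟩ := bag0_edge_inl v (hroot v w hne h)
        exact ⟨i, h1, h ▸ h2⟩
      · obtain ⟨i, h1, h2⟩ := bag0_edge_inl w (hroot w v hne.symm h)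
        exact ⟨i, h ▸ h2, h1⟩
      · obtain ⟨i, h1, h2⟩ := bag0_edge_inr v (hroot v w hne h)
        exact ⟨i, h1, h ▸ h2⟩
      · obtain ⟨i, h1, h2⟩ := bag0_edge_inr w (hroot w v hne.symm h)
        exact ⟨i, h ▸ h2, h1⟩
    intro x y hxy
    rw [DG, displayGraph, SimpleGraph.fromRel_adj] at hxy
    rcases hxy with ⟨-, h | h⟩
    · exact key x y h
    · obtain ⟨i, h1, h2⟩ := key y x h
      exact ⟨i, h2, h1⟩
  · intro x
    simp only [hbag]
    exact bag0_top x.1 ((merge_eq x.1).symm.trans x.2)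
  · intro i
    refine le_trans ?_ (bag0_card i)
    exact Finset.card_le_card_of_injOn Subtype.val (fun x hx => (hbag x i).1 hx)
      Subtype.val_injective.injOn

/-! ### The lower bound -/

/-- The branch sets of a `K₄` minor. -/
noncomputable def br (i : Fin n) :
    Fin 4 → Set (DisplayVertex (leaf1 : Lab n → Vt n) (leaf2 : Lab n → Vt n))
  | 0 => {D (Sum.inl (a i false true)), D (Sum.inr (u i false)), D (Sum.inl (a i false false)),
      D (Sum.inl (u i false))}
  | 1 => {D (Sum.inr (u i true)), D (Sum.inl (a i true true)), D (Sum.inl (u i true))}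
  | 2 => {D (Sum.inl (p ⟨i.1, by omega⟩)), D (Sum.inl (p ⟨i.1 + 1, by omega⟩)), D (Sum.inl (r i))}
  | 3 => {D (Sum.inr (p ⟨i.1 + 1, by omega⟩)), D (Sum.inr (r i))}

lemma adj_au (i : Fin n) (b c : Bool) :
    (DG n).Adj (D (Sum.inl (a i b c))) (D (Sum.inl (u i b))) :=
  DG_adj_inl (a i b c) (by simp)

lemma adj_aw (i : Fin n) (b c : Bool) :
    (DG n).Adj (D (Sum.inl (a i b c))) (D (Sum.inr (u i c))) := by
  have := DG_adj_inr (a i c b) (by simp) (by simp [nf, par])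
  have e : D (Sum.inl (a i b c)) = D (Sum.inr (a i c b)) := by
    rw [D_eq_iff]; rfl
  rw [e]
  exact this

lemma adj_ur (i : Fin n) (b : Bool) :
    (DG n).Adj (D (Sum.inl (u i b))) (D (Sum.inl (r i))) :=
  DG_adj_inl (u i b) (by simp)

lemma adj_ws (i : Fin n) (b : Bool) :
    (DG n).Adj (D (Sum.inr (u i b))) (D (Sum.inr (r i))) :=
  DG_adj_inr (u i b) (by simp) (by simp [nf, par])

lemma adj_rp (i : Fin n) :
    (DG n).Adj (D (Sum.inl (r i))) (D (Sum.inl (p ⟨i.1 + 1, by omega⟩))) :=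
  DG_adj_inl (r i) (by simp)

lemma adj_sq (i : Fin n) :
    (DG n).Adj (D (Sum.inr (r i))) (D (Sum.inr (p ⟨i.1 + 1, by omega⟩))) :=
  DG_adj_inr (r i) (by simp) (by simp only [nf, par]; split_ifs <;> simp)

lemma adj_pp (i : Fin n) :
    (DG n).Adj (D (Sum.inl (p ⟨i.1 + 1, by omega⟩))) (D (Sum.inl (p ⟨i.1, by omega⟩))) :=
  DG_adj_inl (p ⟨i.1 + 1, by omega⟩) (by simp [Fin.ext_iff])

lemma adj_pq (i : Fin n) (hi : i.1 = 0) :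
    (DG n).Adj (D (Sum.inl (p ⟨i.1, by omega⟩))) (D (Sum.inr (p ⟨i.1 + 1, by omega⟩))) := by
  have h1 : i.1 ≠ n := by omega
  have := DG_adj_inr (p ⟨i.1 + 1, by omega⟩) (by simp [Fin.ext_iff])
    (by
      have h2 : nf (Sum.inr (p ⟨i.1 + 1, by omega⟩ : Vt n)) = Sum.inr (p ⟨i.1 + 1, by omega⟩) := by
        simp [nf, h1]
      have h3 : nf (Sum.inr (p ⟨i.1, by omega⟩ : Vt n)) = Sum.inl (p ⟨i.1, by omega⟩) := by
        simp [nf, hi]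
      have h4 : par (p ⟨i.1 + 1, by omega⟩ : Vt n) = p ⟨i.1, by omega⟩ := rfl
      rw [h4, h2, h3]
      simp)
  have e : D (Sum.inl (p ⟨i.1, by omega⟩)) = D (Sum.inr (p ⟨i.1, by omega⟩ : Vt n)) := by
    rw [D_eq_iff]; simp [nf, hi]
  rw [e]
  exact this.symm

lemma no_TD (hn : 0 < n) : ¬ HasTreeDecompWidthLE (DG n) 2 := by
  let i : Fin n := ⟨0, hn⟩
  have hi : i.1 = 0 := rfl
  clear_value i
  have h1 : i.1 ≠ n := by omega
  refine no_treeDecomp_of_K4 (DG n) (br i) ?_ ?_ ?_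
  · intro k
    fin_cases k
    · refine ConnSet.step _ (D (Sum.inl (u i false))) _ ?_ (by simp) (adj_au i false true).symm
      refine ConnSet.step _ (D (Sum.inl (a i false false))) _ ?_ (by simp) (adj_aw i false false)
      exact ConnSet.step _ _ _ (ConnSet.single _) rfl (adj_au i false false).symm
    · refine ConnSet.step _ (D (Sum.inl (a i true true))) _ ?_ (by simp) (adj_aw i true true)
      exact ConnSet.step _ _ _ (ConnSet.single _) rfl (adj_au i true true).symm
    · refine ConnSet.step _ (D (Sum.inl (p ⟨i.1 + 1, by omega⟩))) _ ?_ (by simp) (adj_pp i)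
      exact ConnSet.step _ _ _ (ConnSet.single _) rfl (adj_rp i)
    · exact ConnSet.step _ _ _ (ConnSet.single _) rfl (adj_sq i)
  · have hlt : ∀ k l, k < l → Disjoint (br i k) (br i l) := by
      intro k l hkl
      rw [Set.disjoint_left]
      intro x hx hy
      fin_cases k <;> fin_cases l <;> simp at hkl <;>
        simp only [br, Set.mem_insert_iff, Set.mem_singleton_iff] at hx hy <;>
        rcases hx with rfl | rfl | rfl | rfl <;>
        simp [D_eq_iff, nf, h1] at hy
    intro k l hkl
    rcases lt_or_gt_of_ne hkl with h | h
    · exact hlt k l h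
    · exact (hlt l k h).symm
  · intro k l hkl
    fin_cases k <;> fin_cases l <;> simp at hkl
    · exact ⟨D (Sum.inl (a i false true)), by simp [br], D (Sum.inr (u i true)), by simp [br],
        adj_aw i false true⟩
    · exact ⟨D (Sum.inl (u i false)), by simp [br], D (Sum.inl (r i)), by simp [br],
        adj_ur i false⟩
    · exact ⟨D (Sum.inr (u i false)), by simp [br], D (Sum.inr (r i)), by simp [br],
        adj_ws i false⟩
    · exact ⟨D (Sum.inl (u i true)), by simp [br], D (Sum.inl (r i)), by simp [br],
        adj_ur i true⟩
    · exact ⟨D (Sum.inr (u i true)), by simp [br], D (Sum.inr (r i)), by simp [br],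
        adj_ws i true⟩
    · exact ⟨_, by simp [br], _, by simp [br], adj_pq i hi⟩

lemma tw_eq (hn : 0 < n) : treewidth (DG n) = 3 := by
  apply le_antisymm
  · exact Nat.sInf_le hasTD
  · apply le_csInf ⟨3, hasTD⟩
    rintro k ⟨N, t, bag, h1, h2, h3, h4, h5⟩
    by_contra hk
    exact no_TD hn ⟨N, t, bag, h1, h2, h3, h4, fun i => (h5 i).trans (by omega)⟩

end Vt

/-- The gap between treewidth distance and maximum parsimony distance can be
arbitrarily large: for every `M` there is a pair of unrooted binary phylogenetic
trees on a common label set with treewidth distance 1 and maximum parsimony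
distance greater than `M`. -/
theorem dtw_one_dMP_unbounded :
    ∀ M : ℕ, ∃ (X V1 V2 : Type) (T1 : PhyloTree V1 X) (T2 : PhyloTree V2 X),
      3 ≤ Nat.card X ∧ dtw T1 T2 = 1 ∧ M < dMP T1 T2 := by
  intro M
  have hn : 0 < M + 1 := Nat.succ_pos M
  refine ⟨Vt.Lab (M + 1), Vt (M + 1), Vt (M + 1), Vt.T1 hn, Vt.T2 hn, ?_, ?_, ?_⟩
  · simp [Vt.Lab]
    omega
  · have h : treewidth (displayGraph (Vt.T1 hn).graph (Vt.T1 hn).leaf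
        (Vt.T2 hn).graph (Vt.T2 hn).leaf) = 3 := Vt.tw_eq hn
    rw [dtw, h]
  · exact Vt.le_dMP hn
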